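/- Suppose χ₁ and χ₂ are both even (χ₁(−1) = χ₂(−1) = 1). Let γ = (a, b; r·q₁q₂, d) ∈ Γ₀(q₁q₂) with r ≥ 1, and let γ' = (d, −r; −b·q₁q₂, a). Then S_{χ₁,χ₂}(γ) = S_{χ₂,χ₁}(γ'). -/

import Mathlib

open Complex Finset
open scoped Classical

/-- The sawtooth function `B₁(x)`: `0` if `x ∈ ℤ`, and `x - ⌊x⌋ - 1/2` otherwise. -/
noncomputable def sawtooth (x : ℝ) : ℝ :=
  if ∃ n : ℤ, (n : ℝ) = x then 0 else Int.fract x - 1 / 2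

/-- The newform Dedekind sum `S_{χ₁,χ₂}(a, c)` associated to Dirichlet characters
`χ₁ mod q₁` and `χ₂ mod q₂`. -/
noncomputable def newformDedekindSum {q₁ q₂ : ℕ} (χ₁ : DirichletCharacter ℂ q₁)
    (χ₂ : DirichletCharacter ℂ q₂) (a c : ℤ) : ℂ :=
  ∑ j ∈ Finset.range c.toNat, ∑ n ∈ Finset.range q₁,
    (starRingEnd ℂ) (χ₂ (j : ZMod q₂)) * (starRingEnd ℂ) (χ₁ (n : ZMod q₁)) *
      (sawtooth ((j : ℝ) / (c : ℝ)) : ℂ) *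
      (sawtooth ((n : ℝ) / (q₁ : ℝ) + (a : ℝ) * (j : ℝ) / (c : ℝ)) : ℂ)

/-- The newform Dedekind sum of a matrix `γ = (a, b; c, d) ∈ SL₂(ℤ)`:
it is `S_{χ₁,χ₂}(a, c)` if `c ≥ 1`, `S_{χ₁,χ₂}(-γ)` if `c ≤ -1`, and `0` if `c = 0`. -/
noncomputable def newformDedekindSumSL {q₁ q₂ : ℕ} (χ₁ : DirichletCharacter ℂ q₁)
    (χ₂ : DirichletCharacter ℂ q₂) (γ : Matrix.SpecialLinearGroup (Fin 2) ℤ) : ℂ :=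
  if γ.1 1 0 = 0 then 0
  else if 1 ≤ γ.1 1 0 then newformDedekindSum χ₁ χ₂ (γ.1 0 0) (γ.1 1 0)
  else newformDedekindSum χ₁ χ₂ (-(γ.1 0 0)) (-(γ.1 1 0))

/-- Membership in `Γ₀(N)`: the lower-left entry is divisible by `N`. -/
def InGamma0 (N : ℕ) (γ : Matrix.SpecialLinearGroup (Fin 2) ℤ) : Prop :=
  (N : ℤ) ∣ γ.1 1 0

/-- Membership in `Γ₁(N)`: lower-left entry divisible by `N` and both diagonal
entries congruent to `1` mod `N`. -/
def InGamma1 (N : ℕ) (γ : Matrix.SpecialLinearGroup (Fin 2) ℤ) : Prop :=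
  InGamma0 N γ ∧ (N : ℤ) ∣ (γ.1 0 0 - 1) ∧ (N : ℤ) ∣ (γ.1 1 1 - 1)

/-- `x` lies in the ring of integers `ℤ[χ₁,χ₂]` of the field `F_{χ₁,χ₂} ⊆ ℂ` generated
by the values of `χ₁` and `χ₂`: `x` lies in the subfield of `ℂ` generated by the values
of the characters and is integral over `ℤ`. -/
def InRingOfIntegers {q₁ q₂ : ℕ} (χ₁ : DirichletCharacter ℂ q₁)
    (χ₂ : DirichletCharacter ℂ q₂) (x : ℂ) : Prop :=
  x ∈ Subfield.closure (Set.range (χ₁ : ZMod q₁ → ℂ) ∪ Set.range (χ₂ : ZMod q₂ → ℂ)) ∧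
    IsIntegral ℤ x

lemma Function.Periodic.eq_of_int_modEq {β : Type*} {F : ℤ → β} {c : ℤ} (hF : Function.Periodic F c)
    {m n : ℤ} (h : m ≡ n [ZMOD c]) : F m = F n := by
  obtain ⟨k, hk⟩ := h.dvd
  rw [show n = m + k * c by linarith]
  exact (hF.int_mul k m).symm

lemma sum_range_affine {c : ℕ} {F : ℤ → ℂ} (hF : Function.Periodic F (c : ℤ)) {u : ℤ}
    (hu : IsCoprime u (c : ℤ)) (k : ℤ) :
    ∑ j ∈ range c, F (u * (j : ℤ) + k) = ∑ j ∈ range c, F (j : ℤ) := by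
  rcases Nat.eq_zero_or_pos c with rfl | hc
  · simp
  have hc' : (0 : ℤ) < c := by exact_mod_cast hc
  have hcast (j : ℕ) : (((u * (j : ℤ) + k) % c).toNat : ℤ) = (u * (j : ℤ) + k) % c :=
    Int.toNat_of_nonneg (Int.emod_nonneg _ hc'.ne')
  have hmaps : Set.MapsTo (fun j : ℕ ↦ ((u * (j : ℤ) + k) % c).toNat) (range c) (range c) := by
    intro j _
    have := Int.emod_lt_of_pos (u * (j : ℤ) + k) hc'
    have := hcast j
    simp only [coe_range, Set.mem_Iio]
    omega
  have hinj : Set.InjOn (fun j : ℕ ↦ ((u * (j : ℤ) + k) % c).toNat) (range c) := by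
    intro i hi j hj hij
    simp only [coe_range, Set.mem_Iio] at hi hj
    have h : (u * (i : ℤ) + k) % c = (u * (j : ℤ) + k) % c := by
      rw [← hcast i, ← hcast j]
      exact congrArg _ hij
    have hdvd : (c : ℤ) ∣ u * ((j : ℤ) - i) := by
      simpa [mul_sub] using Int.ModEq.dvd h
    have hmod : (i : ℤ) ≡ j [ZMOD c] := Int.modEq_iff_dvd.2 (hu.symm.dvd_of_dvd_mul_left hdvd)
    exact Nat.ModEq.eq_of_lt_of_lt ((Int.natCast_modEq_iff).1 hmod) hi hj
  refine Finset.sum_nbij _ hmaps hinj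
    (Finset.surjOn_of_injOn_of_card_le _ hmaps hinj le_rfl) fun j _ ↦ ?_
  rw [hcast]
  exact hF.eq_of_int_modEq (Int.mod_modEq _ _).symm

lemma sum_range_shift {c : ℕ} {F : ℤ → ℂ} (hF : Function.Periodic F (c : ℤ)) (k : ℤ) :
    ∑ j ∈ range c, F ((j : ℤ) + k) = ∑ j ∈ range c, F (j : ℤ) := by
  simpa using sum_range_affine hF isCoprime_one_left k

lemma sum_range_neg {c : ℕ} {F : ℤ → ℂ} (hF : Function.Periodic F (c : ℤ)) :
    ∑ j ∈ range c, F (-(j : ℤ)) = ∑ j ∈ range c, F (j : ℤ) := by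
  simpa using sum_range_affine hF (isCoprime_one_left.neg_left) 0

lemma sum_range_mul_eq (a q : ℕ) (F : ℤ → ℂ) :
    ∑ p ∈ range (a * q), F (p : ℤ) =
      ∑ n ∈ range q, ∑ k ∈ range a, F ((n : ℤ) + q * (k : ℤ)) := by
  rw [Finset.sum_comm]
  induction a with
  | zero => simp
  | succ a ih =>
    rw [Nat.succ_mul, Finset.sum_range_add, ih, Finset.sum_range_succ]
    congr 1
    refine Finset.sum_congr rfl fun n _ ↦ congrArg F ?_
    push_cast
    ring

lemma sawtooth_eq (x : ℝ) : sawtooth x = (Int.fract x - Int.fract (-x)) / 2 := by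
  unfold sawtooth
  split_ifs with h
  · obtain ⟨n, rfl⟩ := h
    rw [← Int.cast_neg, Int.fract_intCast, Int.fract_intCast]
    norm_num
  · rw [Int.fract_neg]
    · ring
    · intro h0
      exact h (Int.fract_eq_zero_iff.1 h0)

lemma sawtooth_neg (x : ℝ) : sawtooth (-x) = -sawtooth x := by
  rw [sawtooth_eq, sawtooth_eq, neg_neg]
  ring

lemma sawtooth_add_int (x : ℝ) (n : ℤ) : sawtooth (x + n) = sawtooth x := by
  rw [sawtooth_eq, sawtooth_eq, Int.fract_add_intCast, neg_add, ← Int.cast_neg,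
    Int.fract_add_intCast]

lemma sawtooth_eq_of_sub_int {x y : ℝ} (n : ℤ) (h : x = y + n) : sawtooth x = sawtooth y := by
  rw [h, sawtooth_add_int]

lemma sum_fract_add_div {a : ℕ} (ha : 0 < a) (x : ℝ) :
    ∑ k ∈ range a, Int.fract (x + (k : ℝ) / a) = Int.fract (a * x) + ((a : ℝ) - 1) / 2 := by
  have ha' : (0 : ℝ) < a := by exact_mod_cast ha
  set t := Int.fract (a * x) with ht
  have hx : x = (t + (⌊a * x⌋ : ℝ)) / a := by
    rw [ht, Int.fract_add_floor]
    field_simp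
  have hper : Function.Periodic (fun k : ℤ ↦ ((Int.fract ((t + (k : ℝ)) / a) : ℝ) : ℂ)) (a : ℤ) := by
    intro k
    have : (t + ((k + (a : ℤ) : ℤ) : ℝ)) / a = (t + k) / a + (1 : ℤ) := by
      push_cast
      field_simp
      ring
    simp only [this, Int.fract_add_intCast]
  have hshift : ∑ k ∈ range a, Int.fract (x + (k : ℝ) / a) =
      ∑ k ∈ range a, Int.fract ((t + (k : ℝ)) / a) := by
    have h := sum_range_shift hper ⌊a * x⌋
    rw [← Complex.ofReal_inj]
    push_cast at h ⊢
    rw [← h]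
    refine Finset.sum_congr rfl fun k _ ↦ ?_
    congr 2
    conv_lhs => rw [hx]
    ring
  have hfract : ∀ k ∈ range a, Int.fract ((t + (k : ℝ)) / a) = t / a + k / a := by
    intro k hk
    have hk' : (k : ℝ) + 1 ≤ a := by exact_mod_cast Finset.mem_range.1 hk
    rw [Int.fract_eq_self.2, add_div]
    have h0 := Int.fract_nonneg (a * x)
    have h1 := Int.fract_lt_one (a * x)
    refine ⟨by positivity, ?_⟩
    rw [div_lt_one ha']
    linarith
  have hsum : ∑ k ∈ range a, (k : ℝ) = a * ((a : ℝ) - 1) / 2 := by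
    clear * -
    induction a with
    | zero => simp
    | succ n ih =>
      rw [Finset.sum_range_succ, ih]
      push_cast
      ring
  rw [hshift, Finset.sum_congr rfl hfract, Finset.sum_add_distrib, ← Finset.sum_div,
    ← Finset.sum_div, hsum]
  simp only [Finset.sum_const, Finset.card_range, nsmul_eq_mul]
  field_simp

lemma sum_sawtooth_add_div {a : ℕ} (ha : 0 < a) (x : ℝ) :
    ∑ k ∈ range a, sawtooth (x + (k : ℝ) / a) = sawtooth (a * x) := by
  have ha' : (a : ℝ) ≠ 0 := by exact_mod_cast ha.ne'
  have hper : Function.Periodic (fun k : ℤ ↦ ((Int.fract (-x + (k : ℝ) / a) : ℝ) : ℂ)) (a : ℤ) := by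
    intro k
    have : -x + ((k + (a : ℤ) : ℤ) : ℝ) / a = -x + k / a + (1 : ℤ) := by
      push_cast
      field_simp
      ring
    simp only [this, Int.fract_add_intCast]
  have hneg : ∑ k ∈ range a, Int.fract (-(x + (k : ℝ) / a)) =
      ∑ k ∈ range a, Int.fract (-x + (k : ℝ) / a) := by
    have h := sum_range_neg hper
    rw [← Complex.ofReal_inj]
    push_cast at h ⊢
    rw [← h]
    refine Finset.sum_congr rfl fun k _ ↦ ?_
    congr 2
    ring
  simp only [sawtooth_eq]
  rw [← Finset.sum_div, Finset.sum_sub_distrib, hneg, sum_fract_add_div ha, sum_fract_add_div ha,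
    mul_neg]
  ring

lemma sawtooth_three_term {x : ℝ} (hx : ¬∃ n : ℤ, (n : ℝ) = x) (y : ℝ) :
    sawtooth y * sawtooth (x - y) - sawtooth x * sawtooth (x - y) = sawtooth x * sawtooth y -
      (Int.fract x ^ 2 - Int.fract x + 1 / 6 + (Int.fract y ^ 2 - Int.fract y + 1 / 6) +
        (Int.fract (x - y) ^ 2 - Int.fract (x - y) + 1 / 6)) / 2 := by
  by_cases hy : ∃ n : ℤ, (n : ℝ) = y
  · obtain ⟨n, rfl⟩ := hy
    have h1 : sawtooth n = 0 := by simp [sawtooth]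
    have h2 : sawtooth (x - n) = sawtooth x := sawtooth_eq_of_sub_int (-n) (by push_cast; ring)
    rw [h1, h2, Int.fract_sub_intCast, Int.fract_intCast]
    simp only [sawtooth, if_neg hx]
    ring
  by_cases hz : ∃ n : ℤ, (n : ℝ) = x - y
  · obtain ⟨n, hn⟩ := hz
    have h1 : sawtooth n = 0 := by simp [sawtooth]
    obtain rfl : x = y + n := by linarith
    rw [← hn, h1, sawtooth_add_int, Int.fract_add_intCast, Int.fract_intCast]
    simp only [sawtooth, if_neg hy]
    ring
  simp only [sawtooth, if_neg hx, if_neg hy, if_neg hz]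
  have hcase : Int.fract (x - y) = Int.fract x - Int.fract y ∨
      Int.fract (x - y) = Int.fract x - Int.fract y + 1 := by
    obtain ⟨k, hk⟩ : ∃ k : ℤ, Int.fract (x - y) = Int.fract x - Int.fract y + k :=
      ⟨⌊x⌋ - ⌊y⌋ - ⌊x - y⌋, by simp only [Int.fract]; push_cast; ring⟩
    have h1 := Int.fract_nonneg x
    have h2 := Int.fract_nonneg y
    have h3 := Int.fract_nonneg (x - y)
    have h4 := Int.fract_lt_one x
    have h5 := Int.fract_lt_one y
    have h6 := Int.fract_lt_one (x - y)
    have hk1 : (-1 : ℝ) < k := by linarith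
    have hk2 : (k : ℝ) < 2 := by linarith
    have hk1' : -1 < k := by exact_mod_cast hk1
    have hk2' : k < 2 := by exact_mod_cast hk2
    obtain rfl | rfl : k = 0 ∨ k = 1 := by omega
    · left; simpa using hk
    · right; simpa using hk
  rcases hcase with h | h <;> rw [h] <;> ring

namespace DirichletCharacter

lemma periodic_int {q : ℕ} (X : DirichletCharacter ℂ q) :
    Function.Periodic (fun n : ℤ ↦ X (n : ZMod q)) (q : ℤ) := by
  intro n
  simp

lemma map_int_add_mul {q : ℕ} (X : DirichletCharacter ℂ q) (n k : ℤ) :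
    X ((n + q * k : ℤ) : ZMod q) = X (n : ZMod q) := by
  simp

lemma sum_range_eq_zero {q : ℕ} (hq : 0 < q) {X : DirichletCharacter ℂ q} (hX : X ≠ 1) :
    ∑ n ∈ range q, X (((n : ℕ) : ℤ) : ZMod q) = 0 := by
  have : NeZero q := ⟨hq.ne'⟩
  rw [← MulChar.sum_eq_zero_of_ne_one hX]
  refine Finset.sum_nbij' (fun n ↦ (n : ZMod q)) ZMod.val (by simp)
    (fun x _ ↦ Finset.mem_range.2 x.val_lt)
    (fun n hn ↦ ZMod.val_cast_of_lt (Finset.mem_range.1 hn)) (by simp) (by simp)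

lemma sum_range_mul_eq_zero {q : ℕ} (hq : 0 < q) {X : DirichletCharacter ℂ q} (hX : X ≠ 1)
    (a : ℕ) : ∑ p ∈ range (a * q), X (((p : ℕ) : ℤ) : ZMod q) = 0 := by
  rw [sum_range_mul_eq a q (fun p ↦ X (p : ZMod q)), Finset.sum_comm]
  refine Finset.sum_eq_zero fun k _ ↦ ?_
  simp only [map_int_add_mul]
  exact sum_range_eq_zero hq hX

lemma map_intCast_neg {q : ℕ} {X : DirichletCharacter ℂ q} (hX : X.Even) (n : ℤ) :
    X ((-n : ℤ) : ZMod q) = X (n : ZMod q) := by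
  rw [Int.cast_neg]
  exact Even.eval_neg X _ hX

lemma map_intCast_mul {q : ℕ} (X : DirichletCharacter ℂ q) (m n : ℤ) :
    X ((m * n : ℤ) : ZMod q) = X (m : ZMod q) * X (n : ZMod q) := by
  rw [Int.cast_mul, map_mul]

lemma sum_mul_sawtooth_eq_zero {q : ℕ} {X : DirichletCharacter ℂ q} (hX : X.Even) {a : ℕ}
    (hM : 0 < a * q) :
    ∑ p ∈ range (a * q),
      X (((p : ℕ) : ℤ) : ZMod q) * (sawtooth (((p : ℤ) : ℝ) / (a * q)) : ℂ) = 0 := by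
  have hM' : (a * q : ℝ) ≠ 0 := by exact_mod_cast hM.ne'
  have hper : Function.Periodic
      (fun p : ℤ ↦ X (p : ZMod q) * (sawtooth ((p : ℝ) / (a * q)) : ℂ)) ((a * q : ℕ) : ℤ) := by
    intro p
    dsimp only
    congr 2
    · simp
    · refine sawtooth_eq_of_sub_int 1 ?_
      push_cast
      rw [add_div, div_self hM']
  have h := sum_range_neg hper
  simp only [map_intCast_neg hX] at h
  simp only [Int.cast_neg, neg_div, sawtooth_neg, Complex.ofReal_neg, mul_neg,
    Finset.sum_neg_distrib] at h
  exact self_eq_neg.1 h.symm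

lemma sum_mul_sawtooth_distribution {q : ℕ} (hq : 0 < q) (X : DirichletCharacter ℂ q) {a : ℕ}
    (ha : 0 < a) (t : ℝ) :
    ∑ p ∈ range (a * q),
      X (((p : ℕ) : ℤ) : ZMod q) * (sawtooth (((p : ℤ) : ℝ) / (a * q) + t) : ℂ) =
    ∑ n ∈ range q, X (((n : ℕ) : ℤ) : ZMod q) * (sawtooth (((n : ℤ) : ℝ) / q + a * t) : ℂ) := by
  have ha' : (a : ℝ) ≠ 0 := by exact_mod_cast ha.ne'
  have hq' : (q : ℝ) ≠ 0 := by exact_mod_cast hq.ne'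
  rw [sum_range_mul_eq a q
    (fun p ↦ X (p : ZMod q) * (sawtooth ((p : ℝ) / (a * q) + t) : ℂ))]
  refine Finset.sum_congr rfl fun n _ ↦ ?_
  simp only [map_int_add_mul]
  rw [← Finset.mul_sum, ← Complex.ofReal_sum]
  congr 2
  have h := sum_sawtooth_add_div ha (((n : ℤ) : ℝ) / (a * q) + t)
  rw [show (a : ℝ) * (((n : ℤ) : ℝ) / (a * q) + t) = ((n : ℤ) : ℝ) / q + a * t by field_simp] at h
  rw [← h]
  refine Finset.sum_congr rfl fun k _ ↦ congrArg sawtooth ?_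
  push_cast
  field_simp
  ring

/-- The newform Dedekind sum with the characters not conjugated. -/
noncomputable def dedekindSum {q₁ q₂ : ℕ} (X : DirichletCharacter ℂ q₁)
    (Y : DirichletCharacter ℂ q₂) (a : ℤ) (c : ℕ) : ℂ :=
  ∑ j ∈ range c, ∑ n ∈ range q₁,
    Y (((j : ℕ) : ℤ) : ZMod q₂) * X (((n : ℕ) : ℤ) : ZMod q₁) *
      (sawtooth (((j : ℤ) : ℝ) / c) : ℂ) *
      (sawtooth (((n : ℤ) : ℝ) / q₁ + a * ((j : ℤ) : ℝ) / c) : ℂ)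

/-- The sum dual to `dedekindSum X Y a (r * q₁ * q₂)` under reciprocity; its modulus is `a`. -/
noncomputable def dualDedekindSum {q₁ q₂ : ℕ} (X : DirichletCharacter ℂ q₁)
    (Y : DirichletCharacter ℂ q₂) (a : ℕ) (r : ℤ) : ℂ :=
  ∑ p ∈ range (a * q₁), ∑ m ∈ range q₂,
    X (((p : ℕ) : ℤ) : ZMod q₁) * Y (((m : ℕ) : ℤ) : ZMod q₂) *
      (sawtooth (((p : ℤ) : ℝ) / (a * q₁)) : ℂ) *
      (sawtooth (((m : ℤ) : ℝ) / q₂ + r * ((p : ℤ) : ℝ) / a) : ℂ)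

lemma sum_sum_mul_periodic_eq_zero {q₁ q₂ : ℕ} (hq₁ : 0 < q₁) (hq₂ : 0 < q₂)
    {X : DirichletCharacter ℂ q₁} (hX : X ≠ 1) (Y : DirichletCharacter ℂ q₂) {a r : ℕ}
    (ha : 0 < a) (hr : 0 < r) (hcop : IsCoprime (a : ℤ) q₁) {f : ℝ → ℂ}
    (hf : Function.Periodic f 1) :
    ∑ p ∈ range (a * q₁), ∑ j ∈ range (r * q₁ * q₂),
      X (((p : ℕ) : ℤ) : ZMod q₁) * Y (((j : ℕ) : ℤ) : ZMod q₂) *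
        f (((p : ℤ) : ℝ) / (a * q₁) - ((j : ℤ) : ℝ) / (r * q₁ * q₂)) = 0 := by
  have ha' : (a : ℝ) ≠ 0 := by exact_mod_cast ha.ne'
  have hr' : (r : ℝ) ≠ 0 := by exact_mod_cast hr.ne'
  have hq₁' : (q₁ : ℝ) ≠ 0 := by exact_mod_cast hq₁.ne'
  have hq₂' : (q₂ : ℝ) ≠ 0 := by exact_mod_cast hq₂.ne'
  set W := ∑ p ∈ range (a * q₁), ∑ j ∈ range (r * q₁ * q₂),
      X (((p : ℕ) : ℤ) : ZMod q₁) * Y (((j : ℕ) : ℤ) : ZMod q₂) *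
        f (((p : ℤ) : ℝ) / (a * q₁) - ((j : ℤ) : ℝ) / (r * q₁ * q₂)) with hW
  have hshift (δ : ℤ) : W = ∑ p ∈ range (a * q₁), ∑ j ∈ range (r * q₁ * q₂),
      X (((a : ℤ) * δ + (p : ℕ) : ℤ) : ZMod q₁) * Y (((j : ℕ) : ℤ) : ZMod q₂) *
        f (((p : ℤ) : ℝ) / (a * q₁) - ((j : ℤ) : ℝ) / (r * q₁ * q₂)) := by
    have hper₁ : Function.Periodic (fun p : ℤ ↦ ∑ j ∈ range (r * q₁ * q₂),
        X (p : ZMod q₁) * Y (((j : ℕ) : ℤ) : ZMod q₂) *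
        f ((p : ℝ) / (a * q₁) - ((j : ℤ) : ℝ) / (r * q₁ * q₂))) ((a * q₁ : ℕ) : ℤ) := by
      intro p
      refine Finset.sum_congr rfl fun j _ ↦ ?_
      congr 1
      · simp
      · refine (congrArg f ?_).trans (hf _)
        push_cast
        field_simp
        ring
    rw [hW, ← sum_range_shift hper₁ (a * δ)]
    refine Finset.sum_congr rfl fun p _ ↦ ?_
    have hper₂ : Function.Periodic (fun j : ℤ ↦
        X (((p : ℕ) + (a : ℤ) * δ : ℤ) : ZMod q₁) * Y (j : ZMod q₂) *
        f ((((p : ℕ) + (a : ℤ) * δ : ℤ) : ℝ) / (a * q₁) - (j : ℝ) / (r * q₁ * q₂)))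
        ((r * q₁ * q₂ : ℕ) : ℤ) := by
      intro j
      dsimp only
      congr 1
      · simp
      · refine (congrArg f ?_).trans (hf.sub_eq _)
        push_cast
        field_simp
        ring
    rw [← sum_range_shift hper₂ (q₂ * (r * δ))]
    refine Finset.sum_congr rfl fun j _ ↦ ?_
    rw [map_int_add_mul, add_comm ((a : ℤ) * δ)]
    congr 2
    push_cast
    field_simp
    ring
  have hmean : (q₁ : ℂ) * W = 0 := by
    have h1 : (q₁ : ℂ) * W = ∑ δ ∈ range q₁, W := by simp
    rw [h1, Finset.sum_congr rfl fun (δ : ℕ) _ ↦ hshift δ, Finset.sum_comm]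
    refine Finset.sum_eq_zero fun p _ ↦ ?_
    rw [Finset.sum_comm]
    refine Finset.sum_eq_zero fun j _ ↦ ?_
    simp only [mul_assoc]
    rw [← Finset.sum_mul, sum_range_affine X.periodic_int hcop, sum_range_eq_zero hq₁ hX, zero_mul]
  exact (mul_eq_zero.1 hmean).resolve_left (by exact_mod_cast hq₁.ne')

lemma dedekindSum_eq_neg_dualDedekindSum {q₁ q₂ : ℕ} (hq₁ : 0 < q₁) (hq₂ : 0 < q₂)
    {X : DirichletCharacter ℂ q₁} {Y : DirichletCharacter ℂ q₂} (hX : X ≠ 1) (hY : Y ≠ 1)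
    (hXe : X.Even) (hYe : Y.Even) {a r : ℕ} (ha : 0 < a) (hr : 0 < r)
    (hcop : IsCoprime (a : ℤ) q₁) :
    dedekindSum X Y a (r * q₁ * q₂) = -dualDedekindSum X Y a r := by
  have ha' : (a : ℝ) ≠ 0 := by exact_mod_cast ha.ne'
  have hr' : (r : ℝ) ≠ 0 := by exact_mod_cast hr.ne'
  have hq₁' : (q₁ : ℝ) ≠ 0 := by exact_mod_cast hq₁.ne'
  have hq₂' : (q₂ : ℝ) ≠ 0 := by exact_mod_cast hq₂.ne'
  let x : ℕ → ℝ := fun p ↦ ((p : ℤ) : ℝ) / (a * q₁)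
  let y : ℕ → ℝ := fun j ↦ ((j : ℤ) : ℝ) / (r * q₁ * q₂)
  let F : ℕ → ℂ := fun p ↦ X ((p : ℤ) : ZMod q₁)
  let G : ℕ → ℂ := fun j ↦ Y ((j : ℤ) : ZMod q₂)
  let f : ℝ → ℂ := fun t ↦ ((Int.fract t ^ 2 - Int.fract t + 1 / 6 : ℝ) : ℂ) / 2
  have hf : Function.Periodic f 1 := by
    intro t
    simp only [f, Int.fract_add_one]
  have hG0 : ∑ j ∈ range (r * q₁ * q₂), G j = 0 := sum_range_mul_eq_zero hq₂ hY (r * q₁)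
  have hF0 : ∑ p ∈ range (a * q₁), F p = 0 := sum_range_mul_eq_zero hq₁ hX a
  have hFs : ∑ p ∈ range (a * q₁), F p * (sawtooth (x p) : ℂ) = 0 :=
    sum_mul_sawtooth_eq_zero hXe (Nat.mul_pos ha hq₁)
  have hpoint (p j : ℕ) :
      F p * G j * ((sawtooth (y j) * sawtooth (x p - y j) : ℝ) : ℂ) -
        F p * G j * ((sawtooth (x p) * sawtooth (x p - y j) : ℝ) : ℂ) =
      F p * (sawtooth (x p) : ℂ) * (G j * (sawtooth (y j) : ℂ)) - F p * f (x p) * G j -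
        F p * (G j * f (y j)) - F p * G j * f (x p - y j) := by
    by_cases hp : ∃ n : ℤ, (n : ℝ) = x p
    · obtain ⟨n, hn⟩ := hp
      have hpn : (p : ℤ) = 0 + q₁ * (a * n) := by
        have h : ((p : ℤ) : ℝ) = n * (a * q₁) := by
          rw [hn]
          simp only [x]
          field_simp
        have h' : (p : ℤ) = n * (a * q₁) := by exact_mod_cast h
        rw [h']
        ring
      have hFp : F p = 0 := by
        simp only [F]
        rw [hpn, map_int_add_mul, Int.cast_zero]
        refine X.map_nonunit fun h0 ↦ hX ?_
        have h1 : Subsingleton (ZMod q₁) := subsingleton_of_zero_eq_one (isUnit_zero_iff.1 h0)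
        exact level_one' X (ZMod.subsingleton_iff.1 h1)
      simp [hFp]
    · rw [← mul_sub, ← Complex.ofReal_sub, sawtooth_three_term hp]
      simp only [f]
      push_cast
      ring
  have hdiff : ∑ p ∈ range (a * q₁), ∑ j ∈ range (r * q₁ * q₂),
        F p * G j * ((sawtooth (y j) * sawtooth (x p - y j) : ℝ) : ℂ) =
      ∑ p ∈ range (a * q₁), ∑ j ∈ range (r * q₁ * q₂),
        F p * G j * ((sawtooth (x p) * sawtooth (x p - y j) : ℝ) : ℂ) := by
    rw [← sub_eq_zero]
    simp only [← Finset.sum_sub_distrib, hpoint]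
    simp only [Finset.sum_sub_distrib, ← Finset.mul_sum, hG0, ← Finset.sum_mul, hF0, hFs,
      mul_zero, zero_mul, sub_zero, zero_sub]
    exact neg_eq_zero.2 (sum_sum_mul_periodic_eq_zero hq₁ hq₂ hX Y ha hr hcop hf)
  have hleft : ∑ p ∈ range (a * q₁), ∑ j ∈ range (r * q₁ * q₂),
        F p * G j * ((sawtooth (y j) * sawtooth (x p - y j) : ℝ) : ℂ) =
      -dedekindSum X Y a (r * q₁ * q₂) := by
    rw [Finset.sum_comm, dedekindSum, ← Finset.sum_neg_distrib]
    refine Finset.sum_congr rfl fun j _ ↦ ?_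
    have hdist := sum_mul_sawtooth_distribution hq₁ X ha (-y j)
    have hper : Function.Periodic (fun n : ℤ ↦
        X (n : ZMod q₁) * (sawtooth ((n : ℝ) / q₁ + a * -y j) : ℂ)) (q₁ : ℤ) := by
      intro n
      dsimp only
      congr 2
      · simp
      · refine sawtooth_eq_of_sub_int 1 ?_
        push_cast
        field_simp
        ring
    rw [← sum_range_neg hper] at hdist
    calc ∑ p ∈ range (a * q₁), F p * G j * ((sawtooth (y j) * sawtooth (x p - y j) : ℝ) : ℂ)
        = G j * (sawtooth (y j) : ℂ) *
          ∑ p ∈ range (a * q₁), F p * (sawtooth (x p + -y j) : ℂ) := by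
          rw [Finset.mul_sum]
          refine Finset.sum_congr rfl fun p _ ↦ ?_
          rw [← sub_eq_add_neg]
          push_cast
          ring
      _ = _ := by
          rw [hdist, Finset.mul_sum, ← Finset.sum_neg_distrib]
          refine Finset.sum_congr rfl fun n _ ↦ ?_
          rw [map_intCast_neg hXe, show ((-(n : ℤ) : ℤ) : ℝ) / q₁ + a * -y j =
            -(((n : ℤ) : ℝ) / q₁ + ((a : ℤ) : ℝ) * ((j : ℤ) : ℝ) / ((r * q₁ * q₂ : ℕ) : ℝ)) by
              simp only [y]; push_cast; ring, sawtooth_neg]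
          simp only [G, y]
          push_cast
          ring
  have hright : ∑ p ∈ range (a * q₁), ∑ j ∈ range (r * q₁ * q₂),
        F p * G j * ((sawtooth (x p) * sawtooth (x p - y j) : ℝ) : ℂ) =
      dualDedekindSum X Y a r := by
    rw [dualDedekindSum]
    refine Finset.sum_congr rfl fun p _ ↦ ?_
    have hdist := sum_mul_sawtooth_distribution hq₂ Y (Nat.mul_pos hr hq₁) (-x p)
    have hper : Function.Periodic (fun n : ℤ ↦
        Y (n : ZMod q₂) * (sawtooth ((n : ℝ) / q₂ + (r * q₁ : ℕ) * -x p) : ℂ)) (q₂ : ℤ) := by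
      intro n
      dsimp only
      congr 2
      · simp
      · refine sawtooth_eq_of_sub_int 1 ?_
        push_cast
        field_simp
        ring
    rw [← sum_range_neg hper] at hdist
    calc ∑ j ∈ range (r * q₁ * q₂),
          F p * G j * ((sawtooth (x p) * sawtooth (x p - y j) : ℝ) : ℂ)
        = -(F p * (sawtooth (x p) : ℂ)) * ∑ j ∈ range (r * q₁ * q₂),
          G j * (sawtooth (((j : ℤ) : ℝ) / ((r * q₁ : ℕ) * q₂) + -x p) : ℂ) := by
          rw [Finset.mul_sum]
          refine Finset.sum_congr rfl fun j _ ↦ ?_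
          rw [show ((j : ℤ) : ℝ) / ((r * q₁ : ℕ) * q₂) + -x p = -(x p - y j) by
            simp only [y]; push_cast; ring, sawtooth_neg]
          push_cast
          ring
      _ = _ := by
          rw [hdist, Finset.mul_sum]
          refine Finset.sum_congr rfl fun n _ ↦ ?_
          rw [map_intCast_neg hYe, show ((-(n : ℤ) : ℤ) : ℝ) / q₂ + (r * q₁ : ℕ) * -x p =
            -(((n : ℤ) : ℝ) / q₂ + ((r : ℤ) : ℝ) * ((p : ℤ) : ℝ) / a) by
              simp only [x]; push_cast; field_simp; ring, sawtooth_neg]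
          simp only [F, x]
          push_cast
          ring
  rw [hleft, hright] at hdiff
  rw [← hdiff, neg_neg]

lemma dualDedekindSum_neg {q₁ q₂ : ℕ} (hq₂ : 0 < q₂) (X : DirichletCharacter ℂ q₁)
    {Y : DirichletCharacter ℂ q₂} (hYe : Y.Even) (a : ℕ) (r : ℤ) :
    dualDedekindSum X Y a (-r) = -dualDedekindSum X Y a r := by
  have hq₂' : (q₂ : ℝ) ≠ 0 := by exact_mod_cast hq₂.ne'
  rw [dualDedekindSum, dualDedekindSum, ← Finset.sum_neg_distrib]
  refine Finset.sum_congr rfl fun p _ ↦ ?_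
  have hper : Function.Periodic (fun m : ℤ ↦ X (((p : ℕ) : ℤ) : ZMod q₁) * Y (m : ZMod q₂) *
      (sawtooth (((p : ℤ) : ℝ) / (a * q₁)) : ℂ) *
      (sawtooth ((m : ℝ) / q₂ + (-r : ℤ) * ((p : ℤ) : ℝ) / a) : ℂ)) (q₂ : ℤ) := by
    intro m
    dsimp only
    congr 2
    · simp
    · refine sawtooth_eq_of_sub_int 1 ?_
      push_cast
      rw [add_div, div_self hq₂']
      ring
  rw [← sum_range_neg hper, ← Finset.sum_neg_distrib]
  refine Finset.sum_congr rfl fun m _ ↦ ?_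
  rw [map_intCast_neg hYe, show ((-(m : ℤ) : ℤ) : ℝ) / q₂ + (-r : ℤ) * ((p : ℤ) : ℝ) / a =
    -(((m : ℤ) : ℝ) / q₂ + r * ((p : ℤ) : ℝ) / a) by push_cast; ring, sawtooth_neg]
  push_cast
  ring

lemma dualDedekindSum_zero {q₁ q₂ : ℕ} (hq₂ : 0 < q₂) (X : DirichletCharacter ℂ q₁)
    {Y : DirichletCharacter ℂ q₂} (hYe : Y.Even) (a : ℕ) :
    dualDedekindSum X Y a 0 = 0 := by
  have h := dualDedekindSum_neg hq₂ X hYe a 0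
  rw [neg_zero] at h
  exact self_eq_neg.1 h

lemma map_mul_dualDedekindSum {q₁ q₂ : ℕ} (hq₂ : 0 < q₂) (X : DirichletCharacter ℂ q₁)
    (Y : DirichletCharacter ℂ q₂) {a : ℕ} (ha : 0 < a) (r : ℤ) :
    Y ((a : ℤ) : ZMod q₂) * dualDedekindSum X Y a r =
      ∑ p ∈ range (a * q₁), ∑ l ∈ range (a * q₂),
        if (a : ℤ) ∣ (l : ℤ) - q₂ * (r * (p : ℤ)) then
          X (((p : ℕ) : ℤ) : ZMod q₁) * Y (((l : ℕ) : ℤ) : ZMod q₂) *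
            (sawtooth (((p : ℤ) : ℝ) / (a * q₁)) : ℂ) *
            (sawtooth (((l : ℤ) : ℝ) / (a * q₂)) : ℂ)
        else 0 := by
  have ha' : (a : ℝ) ≠ 0 := by exact_mod_cast ha.ne'
  have hq₂' : (q₂ : ℝ) ≠ 0 := by exact_mod_cast hq₂.ne'
  rw [dualDedekindSum, Finset.mul_sum]
  refine Finset.sum_congr rfl fun p _ ↦ ?_
  have hper : Function.Periodic (fun l : ℤ ↦
        if (a : ℤ) ∣ l - q₂ * (r * (p : ℤ)) then
          X (((p : ℕ) : ℤ) : ZMod q₁) * Y (l : ZMod q₂) *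
            (sawtooth (((p : ℤ) : ℝ) / (a * q₁)) : ℂ) * (sawtooth ((l : ℝ) / (a * q₂)) : ℂ)
        else 0) ((a * q₂ : ℕ) : ℤ) := by
    intro l
    have hiff : (a : ℤ) ∣ l + ((a * q₂ : ℕ) : ℤ) - q₂ * (r * (p : ℤ)) ↔
        (a : ℤ) ∣ l - q₂ * (r * (p : ℤ)) := by
      rw [show l + ((a * q₂ : ℕ) : ℤ) - q₂ * (r * (p : ℤ)) =
        l - q₂ * (r * (p : ℤ)) + a * q₂ by push_cast; ring]
      exact dvd_add_left (dvd_mul_right _ _)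
    dsimp only
    simp only [hiff]
    congr 3
    · simp
    · refine sawtooth_eq_of_sub_int 1 ?_
      push_cast
      rw [add_div, div_self (mul_ne_zero ha' hq₂')]
  rw [← sum_range_shift hper (q₂ * (r * (p : ℤ)))]
  simp only [add_sub_cancel_right]
  have hsplit := sum_range_mul_eq q₂ a (fun l : ℤ ↦ if (a : ℤ) ∣ l then
          X (((p : ℕ) : ℤ) : ZMod q₁) * Y ((l + q₂ * (r * (p : ℤ)) : ℤ) : ZMod q₂) *
            (sawtooth (((p : ℤ) : ℝ) / (a * q₁)) : ℂ) *
            (sawtooth (((l + q₂ * (r * (p : ℤ)) : ℤ) : ℝ) / (a * q₂)) : ℂ)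
        else 0)
  rw [mul_comm q₂ a] at hsplit
  rw [hsplit, Finset.sum_eq_single_of_mem 0 (Finset.mem_range.2 ha), Finset.mul_sum]
  · refine Finset.sum_congr rfl fun m _ ↦ ?_
    rw [if_pos (by simp), map_int_add_mul, Nat.cast_zero, zero_add, map_intCast_mul,
      show (((a : ℤ) * (m : ℤ) + q₂ * (r * (p : ℤ)) : ℤ) : ℝ) / (a * q₂) =
        ((m : ℤ) : ℝ) / q₂ + r * ((p : ℤ) : ℝ) / a by push_cast; field_simp]
    ring
  · intro n hn hn0
    refine Finset.sum_eq_zero fun k _ ↦ if_neg fun hdvd ↦ hn0 ?_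
    have h1 : (a : ℤ) ∣ n := (dvd_add_left (dvd_mul_right _ _)).1 hdvd
    exact Nat.eq_zero_of_dvd_of_lt (Int.natCast_dvd_natCast.1 h1) (Finset.mem_range.1 hn)

lemma map_mul_dualDedekindSum_comm {q₁ q₂ : ℕ} (hq₁ : 0 < q₁) (hq₂ : 0 < q₂)
    (X : DirichletCharacter ℂ q₁) (Y : DirichletCharacter ℂ q₂) {a : ℕ} (ha : 0 < a) {r s d : ℤ}
    (h : a * d + s * r * (q₁ * q₂) = 1) :
    Y ((a : ℤ) : ZMod q₂) * dualDedekindSum X Y a r =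
      X ((a : ℤ) : ZMod q₁) * dualDedekindSum Y X a s := by
  rw [map_mul_dualDedekindSum hq₂ X Y ha, map_mul_dualDedekindSum hq₁ Y X ha, Finset.sum_comm]
  refine Finset.sum_congr rfl fun l _ ↦ Finset.sum_congr rfl fun p _ ↦ ?_
  have hiff : (a : ℤ) ∣ (l : ℤ) - q₂ * (r * (p : ℤ)) ↔ (a : ℤ) ∣ (p : ℤ) - q₁ * (s * (l : ℤ)) := by
    constructor
    · rintro ⟨k, hk⟩
      exact ⟨d * p - q₁ * s * k, by linear_combination (-(q₁ : ℤ) * s) * hk - (p : ℤ) * h⟩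
    · rintro ⟨k, hk⟩
      exact ⟨d * l - q₂ * r * k, by linear_combination (-(q₂ : ℤ) * r) * hk - (l : ℤ) * h⟩
  simp only [hiff]
  refine if_congr Iff.rfl ?_ rfl
  ring

lemma dedekindSum_neg {q₁ q₂ : ℕ} (hq₁ : 0 < q₁) {X : DirichletCharacter ℂ q₁} (hXe : X.Even)
    (Y : DirichletCharacter ℂ q₂) (a : ℤ) (c : ℕ) :
    dedekindSum X Y (-a) c = -dedekindSum X Y a c := by
  have hq₁' : (q₁ : ℝ) ≠ 0 := by exact_mod_cast hq₁.ne'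
  rw [dedekindSum, dedekindSum, ← Finset.sum_neg_distrib]
  refine Finset.sum_congr rfl fun j _ ↦ ?_
  have hper : Function.Periodic (fun n : ℤ ↦ Y (((j : ℕ) : ℤ) : ZMod q₂) * X (n : ZMod q₁) *
      (sawtooth (((j : ℤ) : ℝ) / c) : ℂ) *
      (sawtooth ((n : ℝ) / q₁ + (-a : ℤ) * ((j : ℤ) : ℝ) / c) : ℂ)) (q₁ : ℤ) := by
    intro n
    dsimp only
    congr 2
    · simp
    · refine sawtooth_eq_of_sub_int 1 ?_
      push_cast
      rw [add_div, div_self hq₁']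
      ring
  rw [← sum_range_neg hper, ← Finset.sum_neg_distrib]
  refine Finset.sum_congr rfl fun n _ ↦ ?_
  rw [map_intCast_neg hXe, show ((-(n : ℤ) : ℤ) : ℝ) / q₁ + (-a : ℤ) * ((j : ℤ) : ℝ) / c =
    -(((n : ℤ) : ℝ) / q₁ + a * ((j : ℤ) : ℝ) / c) by push_cast; ring, sawtooth_neg]
  push_cast
  ring

lemma map_mul_dedekindSum_inverse {q₁ q₂ : ℕ} {X : DirichletCharacter ℂ q₁} (hXe : X.Even)
    (Y : DirichletCharacter ℂ q₂) {c : ℕ} (hc : 0 < c) (hdvd : q₁ * q₂ ∣ c) {a d k : ℤ}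
    (hk : a * d = 1 + c * k) :
    X (a : ZMod q₁) * dedekindSum X Y d c = Y (a : ZMod q₂) * dedekindSum X Y a c := by
  obtain ⟨e, rfl⟩ := hdvd
  have hc' : (q₁ * q₂ * e : ℝ) ≠ 0 := by exact_mod_cast hc.ne'
  have hq₁' : (q₁ : ℝ) ≠ 0 := fun h ↦ by simp [h] at hc'
  have hq₂' : (q₂ : ℝ) ≠ 0 := fun h ↦ by simp [h] at hc'
  have he' : (e : ℝ) ≠ 0 := fun h ↦ by simp [h] at hc'
  have hcop : IsCoprime a ((q₁ * q₂ * e : ℕ) : ℤ) := ⟨d, -k, by linear_combination hk⟩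
  have hcop₁ : IsCoprime (-a) (q₁ : ℤ) := by
    refine (hcop.of_isCoprime_of_dvd_right ?_).neg_left
    exact_mod_cast Dvd.intro (q₂ * e) (mul_assoc q₁ q₂ e).symm
  have hk' : (a : ℝ) * d = 1 + q₁ * q₂ * e * k := by exact_mod_cast hk
  rw [dedekindSum, Finset.sum_comm, dedekindSum, Finset.mul_sum, Finset.mul_sum]
  have hper (n : ℕ) : Function.Periodic (fun j : ℤ ↦
      Y (j : ZMod q₂) * X (((n : ℕ) : ℤ) : ZMod q₁) *
      (sawtooth ((j : ℝ) / (q₁ * q₂ * e : ℕ)) : ℂ) *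
      (sawtooth (((n : ℤ) : ℝ) / q₁ + d * (j : ℝ) / (q₁ * q₂ * e : ℕ)) : ℂ))
      ((q₁ * q₂ * e : ℕ) : ℤ) := by
    intro j
    dsimp only
    congr 2
    · simp
    · refine congrArg Complex.ofReal (sawtooth_eq_of_sub_int 1 ?_)
      push_cast
      rw [add_div, div_self hc']
    · refine sawtooth_eq_of_sub_int d ?_
      push_cast
      field_simp
      ring
  have hinner (n : ℕ) := sum_range_affine (hper n) hcop (q₂ * (-(a * e * n)))
  simp only [map_int_add_mul] at hinner
  simp only [← hinner, Finset.mul_sum]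
  rw [Finset.sum_comm]
  refine Finset.sum_congr rfl fun j _ ↦ ?_
  have hper₁ : Function.Periodic (fun n : ℤ ↦ Y (a : ZMod q₂) *
      (Y (((j : ℕ) : ℤ) : ZMod q₂) * X (n : ZMod q₁) *
      (sawtooth (((j : ℤ) : ℝ) / (q₁ * q₂ * e : ℕ)) : ℂ) *
      (sawtooth ((n : ℝ) / q₁ + a * ((j : ℤ) : ℝ) / (q₁ * q₂ * e : ℕ)) : ℂ))) (q₁ : ℤ) := by
    intro n
    dsimp only
    congr 3
    · simp
    · refine sawtooth_eq_of_sub_int 1 ?_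
      push_cast
      rw [add_div, div_self hq₁']
      ring
  rw [← sum_range_affine hper₁ hcop₁ 0]
  refine Finset.sum_congr rfl fun n _ ↦ ?_
  have h1 : sawtooth (((a * (j : ℤ) + q₂ * (-(a * e * n)) : ℤ) : ℝ) / (q₁ * q₂ * e : ℕ)) =
      sawtooth (((-a * (n : ℤ) + 0 : ℤ) : ℝ) / q₁ + a * ((j : ℤ) : ℝ) / (q₁ * q₂ * e : ℕ)) := by
    congr 1
    push_cast
    field_simp
    ring
  have h2 : sawtooth (((n : ℤ) : ℝ) / q₁ +
        d * ((a * (j : ℤ) + q₂ * (-(a * e * n)) : ℤ) : ℝ) / (q₁ * q₂ * e : ℕ)) =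
      sawtooth (((j : ℤ) : ℝ) / (q₁ * q₂ * e : ℕ)) := by
    refine sawtooth_eq_of_sub_int (k * (j - q₂ * e * n)) ?_
    push_cast
    field_simp
    linear_combination ((j : ℝ) - q₂ * e * n) * hk'
  rw [h1, h2, add_zero, neg_mul, map_intCast_neg hXe, map_intCast_mul, map_intCast_mul]
  ring

/-- The newform Dedekind sum, extended to all integers `c` as an even function of `(a, c)`. -/
noncomputable def signedDedekindSum {q₁ q₂ : ℕ} (X : DirichletCharacter ℂ q₁)
    (Y : DirichletCharacter ℂ q₂) (a c : ℤ) : ℂ :=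
  if c = 0 then 0
  else if 1 ≤ c then dedekindSum X Y a c.toNat
  else dedekindSum X Y (-a) (-c).toNat

lemma signedDedekindSum_neg_left {q₁ q₂ : ℕ} (hq₁ : 0 < q₁) {X : DirichletCharacter ℂ q₁}
    (hXe : X.Even) (Y : DirichletCharacter ℂ q₂) (a c : ℤ) :
    signedDedekindSum X Y (-a) c = -signedDedekindSum X Y a c := by
  unfold signedDedekindSum
  split_ifs
  · simp
  · exact dedekindSum_neg hq₁ hXe Y a _
  · exact dedekindSum_neg hq₁ hXe Y (-a) _

lemma signedDedekindSum_neg_right {q₁ q₂ : ℕ} (hq₁ : 0 < q₁) {X : DirichletCharacter ℂ q₁}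
    (hXe : X.Even) (Y : DirichletCharacter ℂ q₂) (a c : ℤ) :
    signedDedekindSum X Y a (-c) = -signedDedekindSum X Y a c := by
  unfold signedDedekindSum
  rcases lt_trichotomy c 0 with h | rfl | h
  · rw [if_neg (by omega), if_pos (by omega), if_neg (by omega), if_neg (by omega),
      dedekindSum_neg hq₁ hXe, neg_neg]
  · simp
  · rw [if_neg (by omega), if_neg (by omega), if_neg (by omega), if_pos (by omega), neg_neg,
      dedekindSum_neg hq₁ hXe]

lemma signedDedekindSum_natCast {q₁ q₂ : ℕ} (X : DirichletCharacter ℂ q₁)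
    (Y : DirichletCharacter ℂ q₂) (a : ℤ) {c : ℕ} (hc : 0 < c) :
    signedDedekindSum X Y a c = dedekindSum X Y a c := by
  rw [signedDedekindSum, if_neg (by omega), if_pos (by omega), Int.toNat_natCast]

lemma map_mul_signedDedekindSum {q₁ q₂ : ℕ} (hq₁ : 0 < q₁) (hq₂ : 0 < q₂)
    {X : DirichletCharacter ℂ q₁} {Y : DirichletCharacter ℂ q₂} (hX : X ≠ 1) (hY : Y ≠ 1)
    (hXe : X.Even) (hYe : Y.Even) {a : ℕ} (ha : 0 < a) {d k s : ℤ}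
    (h : a * d + s * k * (q₁ * q₂) = 1) (hcop : IsCoprime (a : ℤ) q₁) :
    X ((a : ℤ) : ZMod q₁) * signedDedekindSum X Y d (s * (q₁ * q₂)) =
      -(Y ((a : ℤ) : ZMod q₂) * dualDedekindSum X Y a s) := by
  have hpos (m : ℕ) (hm : 0 < m) (l : ℤ) (hl : a * d + m * l * (q₁ * q₂) = 1) :
      X ((a : ℤ) : ZMod q₁) * signedDedekindSum X Y d (m * (q₁ * q₂)) =
      -(Y ((a : ℤ) : ZMod q₂) * dualDedekindSum X Y a m) := by
    have hM : 0 < m * q₁ * q₂ := by positivity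
    rw [show (m : ℤ) * (q₁ * q₂) = ((m * q₁ * q₂ : ℕ) : ℤ) by push_cast; ring,
      signedDedekindSum_natCast X Y d hM,
      map_mul_dedekindSum_inverse hXe Y hM ⟨m, by ring⟩ (a := a) (k := -l)
        (by push_cast; linear_combination hl),
      dedekindSum_eq_neg_dualDedekindSum hq₁ hq₂ hX hY hXe hYe ha hm hcop, mul_neg]
  obtain ⟨m, rfl | rfl⟩ := s.eq_nat_or_neg
  · rcases Nat.eq_zero_or_pos m with rfl | hm
    · simp [signedDedekindSum, dualDedekindSum_zero hq₂ X hYe]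
    · exact hpos m hm k h
  · rcases Nat.eq_zero_or_pos m with rfl | hm
    · simp [signedDedekindSum, dualDedekindSum_zero hq₂ X hYe]
    · rw [neg_mul, signedDedekindSum_neg_right hq₁ hXe, dualDedekindSum_neg hq₂ X hYe, mul_neg,
        hpos m hm (-k) (by linear_combination h), mul_neg]

lemma signedDedekindSum_reciprocity {q₁ q₂ : ℕ} (hq₁ : 0 < q₁) (hq₂ : 0 < q₂)
    {X : DirichletCharacter ℂ q₁} {Y : DirichletCharacter ℂ q₂} (hX : X ≠ 1) (hY : Y ≠ 1)
    (hXe : X.Even) (hYe : Y.Even) {a d r s : ℤ} (ha : a ≠ 0) (hr : 0 < r)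
    (h : a * d + s * r * (q₁ * q₂) = 1) :
    signedDedekindSum X Y a (r * (q₁ * q₂)) = signedDedekindSum Y X d (s * (q₂ * q₁)) := by
  have hpos (a : ℕ) (ha : 0 < a) (d : ℤ) (h : a * d + s * r * (q₁ * q₂) = 1) :
      signedDedekindSum X Y a (r * (q₁ * q₂)) = signedDedekindSum Y X d (s * (q₂ * q₁)) := by
    have hcop₁ : IsCoprime (a : ℤ) q₁ := ⟨d, s * r * q₂, by linear_combination h⟩
    have hcop₂ : IsCoprime (a : ℤ) q₂ := ⟨d, s * r * q₁, by linear_combination h⟩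
    have hYa : Y ((a : ℤ) : ZMod q₂) ≠ 0 := by
      refine ((ZMod.coe_int_isUnit_iff_isCoprime _ _).2 hcop₂.symm).map Y |>.ne_zero
    lift r to ℕ using hr.le
    have hr' : 0 < r := by exact_mod_cast hr
    refine mul_left_cancel₀ hYa ?_
    rw [map_mul_signedDedekindSum hq₂ hq₁ hY hX hYe hXe ha (k := r)
        (by linear_combination h) hcop₂,
      ← map_mul_dualDedekindSum_comm hq₁ hq₂ X Y ha h, ← mul_neg,
      ← dedekindSum_eq_neg_dualDedekindSum hq₁ hq₂ hX hY hXe hYe ha hr' hcop₁,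
      ← signedDedekindSum_natCast X Y a (by positivity)]
    push_cast
    rw [mul_assoc (r : ℤ)]
  obtain ⟨m, rfl | rfl⟩ := a.eq_nat_or_neg
  · exact hpos m (by omega) d h
  · have := hpos m (by omega) (-d) (by linear_combination h)
    rw [signedDedekindSum_neg_left hq₂ hYe] at this
    rw [signedDedekindSum_neg_left hq₁ hXe, this, neg_neg]

lemma newformDedekindSumSL_eq {q₁ q₂ : ℕ} (χ₁ : DirichletCharacter ℂ q₁)
    (χ₂ : DirichletCharacter ℂ q₂) (γ : Matrix.SpecialLinearGroup (Fin 2) ℤ) :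
    newformDedekindSumSL χ₁ χ₂ γ = signedDedekindSum χ₁⁻¹ χ₂⁻¹ (γ.1 0 0) (γ.1 1 0) := by
  have hsum (a c : ℤ) (hc : 0 ≤ c) :
      newformDedekindSum χ₁ χ₂ a c = dedekindSum χ₁⁻¹ χ₂⁻¹ a c.toNat := by
    lift c to ℕ using hc
    simp only [newformDedekindSum, dedekindSum, Int.toNat_natCast, starRingEnd_apply,
      MulChar.star_apply', Int.cast_natCast]
  unfold newformDedekindSumSL signedDedekindSum
  split_ifs with h0 h1
  · rfl
  · exact hsum _ _ (by omega)
  · exact hsum _ _ (by omega)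

end DirichletCharacter

theorem newform_dedekind_sum_reciprocity_even {q₁ q₂ : ℕ} (hq₁ : 0 < q₁) (hq₂ : 0 < q₂)
    (χ₁ : DirichletCharacter ℂ q₁) (χ₂ : DirichletCharacter ℂ q₂)
    (hχ₁ : χ₁ ≠ 1) (hχ₂ : χ₂ ≠ 1) (hp₁ : χ₁.IsPrimitive) (hp₂ : χ₂.IsPrimitive)
    (hpar : χ₁ (-1) * χ₂ (-1) = 1)
    (he₁ : χ₁ (-1) = 1) (he₂ : χ₂ (-1) = 1)
    (γ γ' : Matrix.SpecialLinearGroup (Fin 2) ℤ) (hγ : InGamma0 (q₁ * q₂) γ)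
    (r : ℤ) (hr : 1 ≤ r) (hc : γ.1 1 0 = r * ((q₁ : ℤ) * (q₂ : ℤ)))
    (h'a : γ'.1 0 0 = γ.1 1 1) (h'b : γ'.1 0 1 = -r)
    (h'c : γ'.1 1 0 = -(γ.1 0 1) * ((q₁ : ℤ) * (q₂ : ℤ))) (h'd : γ'.1 1 1 = γ.1 0 0) :
    newformDedekindSumSL χ₁ χ₂ γ = newformDedekindSumSL χ₂ χ₁ γ' := by
  have hdet := Matrix.det_fin_two γ.1
  rw [γ.2, hc] at hdet
  have ha : γ.1 0 0 ≠ 0 := by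
    intro h0
    have hunit : IsUnit ((q₁ : ℤ) * q₂) :=
      IsUnit.of_mul_eq_one (-(γ.1 0 1 * r)) (by rw [h0] at hdet; linear_combination -hdet)
    have h1 := isUnit_of_mul_isUnit_left hunit
    rw [Int.isUnit_iff] at h1
    exact hχ₁ (DirichletCharacter.level_one' χ₁ (by omega))
  have hinv {q : ℕ} {χ : DirichletCharacter ℂ q} (h : χ (-1) = 1) : (χ⁻¹).Even := by
    rw [DirichletCharacter.Even, MulChar.inv_apply_eq_inv', h, inv_one]
  rw [DirichletCharacter.newformDedekindSumSL_eq, DirichletCharacter.newformDedekindSumSL_eq,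
    hc, h'a, h'c, DirichletCharacter.signedDedekindSum_reciprocity hq₁ hq₂ (inv_ne_one.2 hχ₁)
      (inv_ne_one.2 hχ₂) (hinv he₁) (hinv he₂) ha (by omega) (d := γ.1 1 1) (s := -(γ.1 0 1))
      (by linear_combination -hdet), mul_comm (q₂ : ℤ)]
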